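/- Let n ≥ 1 be a natural number and let v : ℝ → ℝ be n-times differentiable on [0, ∞). Suppose all the iterated derivatives v⁽ᵏ⁾ for 0 ≤ k ≤ n are continuous on [0, ∞), and there exist constants C > 0 and β ∈ ℝ with |v⁽ᵏ⁾(t)| ≤ C·exp(β·t) for all t ≥ 0 and all 0 ≤ k ≤ n. Then for all s > 0 and u > 0 with s/u > β, Θ[v⁽ⁿ⁾](s,u) = (s/u)ⁿ·Θ[v](s,u) − Σ_{k=0}^{n-1} (s/u)^{n-(k+1)}·v⁽ᵏ⁾(0). -/

import Mathlib

open MeasureTheory Real Set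

open Filter Topology

lemma abs_exp_mul_le_of_exp_bound {f : ℝ → ℝ} {C β p t : ℝ}
    (hf : |f t| ≤ C * Real.exp (β * t)) :
    |Real.exp (-p * t) * f t| ≤ C * Real.exp (-(p - β) * t) := by
  rw [abs_mul, abs_of_pos (Real.exp_pos _)]
  calc Real.exp (-p * t) * |f t| ≤ Real.exp (-p * t) * (C * Real.exp (β * t)) := by gcongr
    _ = C * (Real.exp (-p * t) * Real.exp (β * t)) := by ring
    _ = C * Real.exp (-(p - β) * t) := by rw [← Real.exp_add]; ring_nf

lemma integrableOn_exp_mul_of_exp_bound {f : ℝ → ℝ} {C β p : ℝ} (hp : β < p)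
    (hc : ContinuousOn f (Ici 0)) (hf : ∀ t, 0 ≤ t → |f t| ≤ C * Real.exp (β * t)) :
    IntegrableOn (fun t => Real.exp (-p * t) * f t) (Ioi 0) := by
  refine ((exp_neg_integrableOn_Ioi 0 (sub_pos.2 hp)).const_mul C).mono' ?_ ?_
  · refine ContinuousOn.aestronglyMeasurable ?_ measurableSet_Ioi
    exact (by fun_prop : Continuous fun t : ℝ => Real.exp (-p * t)).continuousOn.mul
      (hc.mono Ioi_subset_Ici_self)
  · filter_upwards [ae_restrict_mem measurableSet_Ioi] with t ht
    exact abs_exp_mul_le_of_exp_bound (hf t (le_of_lt ht))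

lemma tendsto_exp_mul_of_exp_bound {f : ℝ → ℝ} {C β p : ℝ} (hp : β < p)
    (hf : ∀ t, 0 ≤ t → |f t| ≤ C * Real.exp (β * t)) :
    Tendsto (fun t => Real.exp (-p * t) * f t) atTop (𝓝 0) := by
  refine squeeze_zero_norm' (a := fun t => C * Real.exp (-(p - β) * t)) ?_ ?_
  · filter_upwards [eventually_ge_atTop 0] with t ht
    exact abs_exp_mul_le_of_exp_bound (hf t ht)
  · rw [← mul_zero C]
    exact (tendsto_exp_atBot.comp
      (tendsto_id.const_mul_atTop_of_neg (neg_neg_iff_pos.2 (sub_pos.2 hp)))).const_mul C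

/-- The Laplace transform of a derivative. -/
lemma integral_exp_mul_deriv_of_exp_bound {f f' : ℝ → ℝ} {C β p : ℝ} (hp : β < p)
    (hfc : ContinuousOn f (Ici 0)) (hfc' : ContinuousOn f' (Ici 0))
    (hd : ∀ t ∈ Ioi (0 : ℝ), HasDerivAt f (f' t) t)
    (hf : ∀ t, 0 ≤ t → |f t| ≤ C * Real.exp (β * t))
    (hf' : ∀ t, 0 ≤ t → |f' t| ≤ C * Real.exp (β * t)) :
    ∫ t in Ioi (0 : ℝ), Real.exp (-p * t) * f' t
      = p * (∫ t in Ioi (0 : ℝ), Real.exp (-p * t) * f t) - f 0 := by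
  have hi := integrableOn_exp_mul_of_exp_bound hp hfc hf
  have hi' := integrableOn_exp_mul_of_exp_bound hp hfc' hf'
  have key := integral_Ioi_of_hasDerivAt_of_tendsto (a := 0) (m := 0)
    (f := fun t => Real.exp (-p * t) * f t)
    (f' := fun t => Real.exp (-p * t) * f' t - p * (Real.exp (-p * t) * f t))
    ((by fun_prop : Continuous fun t : ℝ => Real.exp (-p * t)).continuousWithinAt.mul
      (hfc 0 self_mem_Ici))
    (fun t ht => by
      have he : HasDerivAt (fun t : ℝ => Real.exp (-p * t)) (Real.exp (-p * t) * (-p)) t := by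
        simpa using ((hasDerivAt_id t).const_mul (-p)).exp
      exact (he.mul (hd t ht)).congr_deriv (by ring))
    (hi'.sub (hi.const_mul p)) (tendsto_exp_mul_of_exp_bound hp hf)
  rw [integral_sub hi' (hi.const_mul p), integral_const_mul] at key
  simp only [mul_zero, Real.exp_zero, one_mul] at key
  linarith

theorem nltit_deriv_n (n : ℕ) (hn : 1 ≤ n) (v : ℝ → ℝ)
    (hv : ContDiffOn ℝ n v (Set.Ici 0))
    (C β : ℝ) (hC : 0 < C)
    (hb : ∀ k ≤ n, ∀ t, 0 ≤ t →
      |iteratedDerivWithin k v (Set.Ici 0) t| ≤ C * Real.exp (β * t)) :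
    ∀ s u : ℝ, 0 < s → 0 < u → β < s / u →
      ∫ t in Set.Ioi (0:ℝ), Real.exp (-s * t / u) * iteratedDerivWithin n v (Set.Ici 0) t
        = (s / u) ^ n * (∫ t in Set.Ioi (0:ℝ), Real.exp (-s * t / u) * v t)
            - ∑ k ∈ Finset.range n,
                (s / u) ^ (n - (k + 1)) * iteratedDerivWithin k v (Set.Ici 0) 0 := by
  intro s u _ _ hp
  have hexp : ∀ t : ℝ, -s * t / u = -(s / u) * t := fun t => by ring
  simp only [hexp]
  generalize s / u = p at hp
  have hs : UniqueDiffOn ℝ (Ici (0 : ℝ)) := uniqueDiffOn_Ici 0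
  have hc : ∀ k ≤ n, ContinuousOn (iteratedDerivWithin k v (Ici 0)) (Ici 0) := fun k hk =>
    hv.continuousOn_iteratedDerivWithin (by exact_mod_cast hk) hs
  suffices h : ∀ m ≤ n,
      ∫ t in Ioi (0 : ℝ), Real.exp (-p * t) * iteratedDerivWithin m v (Ici 0) t
        = p ^ m * (∫ t in Ioi (0 : ℝ), Real.exp (-p * t) * v t)
          - ∑ k ∈ Finset.range m, p ^ (m - (k + 1)) * iteratedDerivWithin k v (Ici 0) 0 from
    h n le_rfl
  intro m
  induction m with
  | zero => simp
  | succ m ih =>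
    intro hm
    have hm' : m ≤ n := Nat.le_of_succ_le hm
    have hd : ∀ t ∈ Ioi (0 : ℝ), HasDerivAt (iteratedDerivWithin m v (Ici 0))
        (iteratedDerivWithin (m + 1) v (Ici 0) t) t := fun t ht => by
      rw [iteratedDerivWithin_succ]
      exact (hv.differentiableOn_iteratedDerivWithin (by exact_mod_cast hm) hs t
        (Ioi_subset_Ici_self ht)).hasDerivWithinAt.hasDerivAt (Ici_mem_nhds ht)
    rw [integral_exp_mul_deriv_of_exp_bound hp (hc m hm') (hc (m + 1) hm) hd (hb m hm')
      (hb (m + 1) hm), ih hm', Finset.sum_range_succ]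
    have hsum : ∑ k ∈ Finset.range m,
        p ^ (m + 1 - (k + 1)) * iteratedDerivWithin k v (Ici 0) 0
        = p * ∑ k ∈ Finset.range m,
          p ^ (m - (k + 1)) * iteratedDerivWithin k v (Ici 0) 0 := by
      rw [Finset.mul_sum]
      refine Finset.sum_congr rfl fun k hk => ?_
      have hk' := Finset.mem_range.1 hk
      rw [show m + 1 - (k + 1) = (m - (k + 1)) + 1 by omega]
      ring
    rw [hsum, Nat.sub_self]
    ring
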